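/- arXiv:1701.00004 — 3 statements merged into one kernel-verified Lean document; each statement's English description precedes it below -/
import Mathlib

section
/- For every group G, every abelian group A regarded as a trivial module, and every natural number d ≥ 1, there is an isomorphism of abelian groups H^d(ℤ × G; A) ≅ H^{d-1}(G; A) ⊕ H^d(G; A). (This is the generalized Künneth formula of the paper, specialized to ordinary group cohomology, where generalized cohomology of the classifying space B(ℤ × G) becomes group cohomology of ℤ × G.) -/
open CategoryTheory Rep Limits

noncomputable section
namespace KunnethAux

section General
variable {k G Γ : Type} [CommRing k] [Group G] [Group Γ] (φ : G →* Γ)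

/-- degreewise map of bar complexes -/
def barMapF (n : ℕ) : free k G (Fin n → G) ⟶ res φ (free k Γ (Fin n → Γ)) :=
  freeLift k G _ fun g => (Finsupp.single (φ ∘ g) (MonoidAlgebra.single 1 1))

lemma barMapF_single (n : ℕ) (x : Fin n → G) (g : G) (r : k) :
    (barMapF (k := k) φ n).hom (Finsupp.single x (MonoidAlgebra.single g r)) =
      Finsupp.single (φ ∘ x) (MonoidAlgebra.single (φ g) r) := by
  simp [barMapF]

lemma barMapF_comm (n : ℕ) :
    barMapF (k := k) φ (n+1) ≫ (resFunctor φ).map (barComplex.d k Γ n) =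
      barComplex.d k G n ≫ barMapF φ n := by
  refine free_ext k G _ _ _ fun i => ?_
  simp only [Rep.hom_comp, Representation.IntertwiningMap.comp_apply]
  rw [barComplex.d_single, map_add, map_sum, barMapF_single, map_one]
  have h := barComplex.d_single (k := k) n (φ ∘ i)
  refine h.trans ?_
  congr 1
  · exact (barMapF_single (k := k) φ n (fun j => i j.succ) (i 0) 1).symm
  · refine Finset.sum_congr rfl fun j _ => ?_
    refine Eq.trans ?_ (barMapF_single (k := k) φ n _ _ _).symm
    rw [map_one]
    congr 1
    exact (Fin.comp_contractNth _ _ (fun x y => map_mul φ x y) j i).symm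

def barMap : barComplex k G ⟶
    ((resFunctor φ).mapHomologicalComplex _).obj (barComplex k Γ) where
  f n := barMapF φ n
  comm' i j hij := by
    obtain rfl : j + 1 = i := hij
    rw [Functor.mapHomologicalComplex_obj_d, barComplex.d_def k G, barComplex.d_def k Γ]
    exact barMapF_comm φ j

open Finsupp TensorProduct in
lemma diagInv (m : ℕ) (f : Fin m → G) (g : G) (r : k) : ∃ y : Fin (m+1) → G,
        (diagonalSuccIsoFree k G m).inv.hom (single f (MonoidAlgebra.single g r)) =
          MonoidAlgebra.single y r := by
  have step1 : (Hom.hom (leftRegularTensorTrivialIsoFree k G (Fin m → G)).inv)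
      (single f (.single g r)) = .single g 1 ⊗ₜ[k] .single f r :=
    Representation.leftRegularTensorTrivialIsoFree_symm_apply_single_single f g r
  have key₁ := Representation.linearizeMap_single (k := k)
    (Action.diagonalSuccIsoTensorTrivial G m).inv (g, f) ((1 : k) * r)
  have key₂ := Representation.LinearizeMonoidal.μ_apply_single_single (k := k)
    (X := Action.leftRegular G) (Y := Action.trivial G (Fin m → G)) g f 1 r
  have key₃ := ((congrArg (fun z => (Representation.linearizeMap
    (Action.diagonalSuccIsoTensorTrivial G m).inv) z) key₂).trans key₁)
  have h : (diagonalSuccIsoFree k G m).inv.hom (single f (MonoidAlgebra.single g r)) =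
    (diagonalSuccIsoTensorTrivial k G m).inv.hom ((Hom.hom (leftRegularTensorTrivialIsoFree k G (Fin m → G)).inv)
      (single f (.single g r))) := rfl
  rw [one_mul] at key₃
  refine ⟨_, (h.trans (congrArg _ step1)).trans (Eq.trans ?_ key₃)⟩
  rfl

lemma barπ (x : Fin 0 → G) :
    (show k from ((barResolution k G).π.f 0).hom (Finsupp.single x (MonoidAlgebra.single 1 1))) = (1 : k) := by
  have h : (barResolution k G).π.f 0 = (diagonalSuccIsoFree k G 0).inv ≫ standardComplex.ε k G := by
    have : (standardComplex.εToSingle₀ k G).f 0 = standardComplex.ε k G := by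
      exact ChainComplex.toSingle₀Equiv_symm_apply_f_zero _ (standardComplex.d_comp_ε k G)
    rw [← this]
    rfl
  obtain ⟨y, hy⟩ := diagInv (k := k) 0 x 1 1
  have h2 := congrArg (fun u => (standardComplex.ε k G).hom u) hy
  rw [h]
  refine Eq.trans h2 ?_
  simp [standardComplex.ε]

variable [(resFunctor.{0} (k := k) φ).PreservesProjectiveObjects]

def resRes : ProjectiveResolution (Rep.trivial k G k) :=
  (resFunctor φ).mapProjectiveResolution (barResolution k Γ)

lemma barMap_π : barMap φ ≫ (resRes (k := k) φ).π = (barResolution k G).π := by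
  apply HomologicalComplex.to_single_hom_ext
  refine free_ext k G _ _ _ fun i => ?_
  refine Eq.trans ?_ (barπ (k := k) i).symm
  refine Eq.trans ?_ (barπ (k := k) (φ ∘ i))
  have := barMapF_single (k := k) φ 0 i 1 1
  rw [map_one] at this
  rw [← this]
  have : (resRes (k := k) φ).π.f 0 = (resFunctor φ).map ((barResolution k Γ).π.f 0) := by
    simp [resRes]
    exact Category.comp_id _
  have h3 : (barMap φ ≫ (resRes (k := k) φ).π).f 0 =
    barMapF φ 0 ≫ (resFunctor φ).map ((barResolution k Γ).π.f 0) := 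
    (HomologicalComplex.comp_f _ _ _).trans (congrArg (fun u => barMapF φ 0 ≫ u) this)
  exact congrArg (fun u : free k G (Fin 0 → G) ⟶ Rep.trivial k G k =>
    u.hom (Finsupp.single i (MonoidAlgebra.single 1 1))) h3

def barEquiv : HomotopyEquiv (barComplex k G)
    (((resFunctor φ).mapHomologicalComplex _).obj (barComplex k Γ)) where
  hom := barMap φ
  inv := ProjectiveResolution.lift (𝟙 _) (resRes φ) (barResolution k G)
  homotopyHomInvId := ProjectiveResolution.liftHomotopy (𝟙 _) (P := barResolution k G)
      (Q := barResolution k G) _ _ (by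
        simp only [CategoryTheory.Functor.map_id, Category.comp_id]
        refine (Category.assoc _ _ _).trans ?_
        refine Eq.trans (congrArg (fun u => barMap φ ≫ u) (ProjectiveResolution.lift_commutes _ _ _)) ?_
        simp only [CategoryTheory.Functor.map_id, Category.comp_id]
        exact barMap_π φ) (by simp only [CategoryTheory.Functor.map_id, Category.comp_id]; exact Category.id_comp _)
  homotopyInvHomId := ProjectiveResolution.liftHomotopy (𝟙 _) (P := resRes φ)
      (Q := resRes φ) _ _ (by
        simp only [CategoryTheory.Functor.map_id, Category.comp_id]
        refine (Category.assoc _ _ _).trans ?_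
        refine Eq.trans (congrArg (fun u => _ ≫ u) (barMap_π φ)) ?_
        refine (ProjectiveResolution.lift_commutes _ _ _).trans ?_
        simp) (by simp only [CategoryTheory.Functor.map_id, Category.comp_id]; exact Category.id_comp _)

end General

section L
variable {k G : Type} [CommRing k] [Group G] (M : Rep.{0} k G)

def LF : (ChainComplex (Rep.{0} k G) ℕ)ᵒᵖ ⥤ CochainComplex (ModuleCat k) ℕ :=
   (((linearYoneda k (Rep.{0} k G)).obj M).rightOp.mapHomologicalComplex _).op ⋙
    HomologicalComplex.unopFunctor _ _

def LFobj (X : ChainComplex (Rep.{0} k G) ℕ) : (LF M).obj (.op X) ≅ X.linearYonedaObj k M := Iso.refl _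

def LFhomotopy {X Y : ChainComplex (Rep.{0} k G) ℕ} {f g : X ⟶ Y} (h : Homotopy f g) :
    Homotopy ((LF M).map f.op) ((LF M).map g.op) :=
  (Functor.mapHomotopy ((linearYoneda k (Rep.{0} k G)).obj M).rightOp h).unop

def LFequiv {X Y : ChainComplex (Rep.{0} k G) ℕ} (h : HomotopyEquiv X Y) :
    HomotopyEquiv ((LF M).obj (.op Y)) ((LF M).obj (.op X)) where
  hom := (LF M).map h.hom.op
  inv := (LF M).map h.inv.op
  homotopyHomInvId := by
    have := LFhomotopy M h.homotopyInvHomId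
    simpa using this
  homotopyInvHomId := by
    have := LFhomotopy M h.homotopyHomInvId
    simpa using this
end L


section Shapiro
variable {k G Γ : Type} [CommRing k] [Group G] [Group Γ] (φ : G →* Γ) (M : Rep.{0} k G)

def counitMap : res φ (coind φ M) ⟶ M := (resCoindHomEquiv.{0} φ (coind φ M) M).symm (𝟙 _)

lemma resCoind_nat {X Y : Rep.{0} k Γ} (d : X ⟶ Y) (f : res φ Y ⟶ M) :
    resCoindToHom φ X M ((resFunctor φ).map d ≫ f) = d ≫ resCoindToHom φ Y M f := by
  ext x h
  refine congrArg f.hom ?_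
  exact hom_comm_apply d h x

def adjIso : (LF M).obj (.op (((resFunctor φ).mapHomologicalComplex _).obj (barComplex k Γ))) ≅
    (barComplex k Γ).linearYonedaObj k (coind φ M) :=
  HomologicalComplex.Hom.isoOfComponents
    (fun _ ↦ (resCoindHomEquiv.{0} φ _ _).toModuleIso) fun _ _ _ ↦
      ModuleCat.hom_ext (LinearMap.ext fun f => (resCoind_nat φ M _ f).symm)

lemma shapiro_comm : (groupCohomology.inhomogeneousCochainsIso (coind φ M)).hom ≫ (adjIso φ M).inv ≫
    (LF M).map (barMap φ).op = groupCohomology.cochainsMap φ (counitMap φ M) ≫ 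
      (groupCohomology.inhomogeneousCochainsIso M).hom := by
  ext n x
  refine free_ext k G _ _ _ fun i => ?_
  have h1 := barMapF_single (k := k) φ n i 1 1
  rw [map_one] at h1
  have h2 : (Representation.freeLift (coind φ M).ρ x) (Finsupp.single (φ ∘ i) (MonoidAlgebra.single 1 1)) = x (φ ∘ i) := by
    rw [Representation.freeLift_single_single, one_smul, map_one]
    rfl
  have h3 : (Representation.freeLift M.ρ (fun j => (counitMap φ M).hom (x (φ ∘ j)))) (Finsupp.single i (MonoidAlgebra.single 1 1)) = (counitMap φ M).hom (x (φ ∘ i)) := by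
    simp
  refine Eq.trans ?_ h3.symm
  rw [← h2, ← h1]
  rfl

variable [(resFunctor.{0} (k := k) φ).PreservesProjectiveObjects]

lemma shapiro (n : ℕ) : IsIso (groupCohomology.map φ (counitMap φ M) n) := by
  have h := shapiro_comm φ M
  have : QuasiIso ((LF M).map (barMap φ).op) := 
    (inferInstance : QuasiIso (LFequiv M (barEquiv φ)).hom)
  have h2 : QuasiIso (groupCohomology.cochainsMap φ (counitMap φ M) ≫ 
      (groupCohomology.inhomogeneousCochainsIso M).hom) := by
    rw [← h]
    exact quasiIso_comp _ _ (hφ := inferInstance) (hφ' := quasiIso_comp _ _ (hφ := inferInstance) (hφ' := this))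
  have h3 : QuasiIso (groupCohomology.cochainsMap φ (counitMap φ M)) := 
    quasiIso_of_comp_right (hφφ' := h2)
  exact (quasiIsoAt_iff_isIso_homologyMap _ n).1 inferInstance
end Shapiro

instance {k G Γ : Type} [CommRing k] [Group G] [Group Γ] :
    (coindFunctor.{0} k (MonoidHom.inr Γ G)).PreservesEpimorphisms where
  preserves {X Y} f hf := by
    refine (Rep.epi_iff_surjective _).2 fun (y : Y.ρ.coindV (MonoidHom.inr Γ G)) => ?_
    obtain ⟨s, hs⟩ := ((Rep.epi_iff_surjective f).1 hf).hasRightInverse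
    let x : X.ρ.coindV (MonoidHom.inr Γ G) := 
      ⟨fun z => X.ρ z.2 (s (y.1 (z.1, 1))), fun g h => by simp⟩
    refine ⟨x, Subtype.ext <| funext fun g => ?_⟩
    have h1 := y.2 g.2 (g.1, 1)
    simp only [MonoidHom.inr_apply, Prod.mk_mul_mk, one_mul, mul_one] at h1
    refine Eq.trans ?_ h1.symm
    refine (hom_comm_apply f _ _).trans ?_
    exact congrArg _ (hs _)

instance {k G Γ : Type} [CommRing k] [Group G] [Group Γ] :
    (resFunctor.{0} (k := k) (MonoidHom.inr Γ G)).PreservesProjectiveObjects :=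
  (resFunctor _).preservesProjectiveObjects_of_adjunction_of_preservesEpimorphisms
    (resCoindAdjunction k _)

section Final
variable (G : Type) [Group G] (A : Type) [AddCommGroup A]

abbrev Zm := Multiplicative ℤ
abbrev F : Rep ℤ (Zm × G) := coind (MonoidHom.inr Zm G) (Rep.trivial ℤ G A)

def iotaM : Rep.trivial ℤ (Zm × G) A ⟶ F G A :=
  resCoindToHom (MonoidHom.inr Zm G) (Rep.trivial ℤ (Zm × G) A) (Rep.trivial ℤ G A) (𝟙 (Rep.trivial ℤ G A))

def tm : Zm × G := (Multiplicative.ofAdd 1, 1)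

def gM : F G A ⟶ F G A := Rep.ofHom
  ⟨(F G A).ρ (tm G) - LinearMap.id, fun h => by
    have : (F G A).ρ (tm G) * (F G A).ρ h = (F G A).ρ h * (F G A).ρ (tm G) := by
      rw [← map_mul, ← map_mul]
      congr 1
      ext <;> simp [tm, mul_comm]
    ext x : 1
    have := LinearMap.congr_fun this x
    simp only [LinearMap.comp_apply, LinearMap.sub_apply, map_sub, LinearMap.id_apply]
    exact congrArg (· - _) this⟩

lemma gM_apply (x : F G A) (z : Zm × G) : ((gM G A).hom x).1 z = x.1 (z * tm G) - x.1 z := rfl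
lemma iotaM_apply (x : A) (z : Zm × G) : ((iotaM G A).hom x).1 z = x := rfl

lemma F_apply (x : F G A) (z : Zm × G) : x.1 z = x.1 (z.1, 1) := by
  have := x.2 z.2 (z.1, 1)
  simpa using this

lemma exists_sum (y : ℤ → A) : ∃ x : ℤ → A, ∀ n, x (n + 1) - x n = y n := by
  refine ⟨fun n => match n with
    | Int.ofNat n => ∑ i ∈ Finset.range n, y i
    | Int.negSucc n => - ∑ i ∈ Finset.range (n+1), y (Int.negSucc i), fun n => ?_⟩
  match n with
  | Int.ofNat n =>
    change (∑ i ∈ Finset.range (n+1), y i) - (∑ i ∈ Finset.range n, y i) = y n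
    simp [Finset.sum_range_succ]
  | Int.negSucc 0 =>
    change (∑ i ∈ Finset.range 0, y i) - (- ∑ i ∈ Finset.range (0+1), y (Int.negSucc i)) = _
    simp
  | Int.negSucc (n+1) =>
    change (- ∑ i ∈ Finset.range (n+1), y (Int.negSucc i)) - (- ∑ i ∈ Finset.range (n+1+1), y (Int.negSucc i)) = _
    rw [Finset.sum_range_succ _ (n+1)]
    abel

def X : ShortComplex (Rep.{0} ℤ (Zm × G)) :=
  ShortComplex.mk (iotaM G A) (gM G A) (by
    ext x : 3
    refine Subtype.ext (funext fun z => ?_)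
    exact sub_self x)

lemma const_of (x : ℤ → A) (h : ∀ n, x (n + 1) = x n) (n : ℤ) : x n = x 0 := by
  induction n with
  | zero => rfl
  | succ n ih => rw [h, ih]
  | pred n ih => rw [← ih, ← h]; congr 1; ring

lemma exact_of_elements {k H : Type} [CommRing k] [Group H] (Y : ShortComplex (Rep.{0} k H))
    (h : ∀ x : Y.X₂, Y.g.hom x = 0 → ∃ y : Y.X₁, Y.f.hom y = x) : Y.Exact := by
  rw [← ShortComplex.exact_map_iff_of_faithful _ (forget₂ (Rep.{0} k H) (ModuleCat.{0} k)),
    ShortComplex.moduleCat_exact_iff]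
  exact h

lemma hX : (X G A).ShortExact where
  exact := by
    refine exact_of_elements _ ?_
    intro (x : F G A) hx
    replace hx : (gM G A).hom x = 0 := hx
    refine ⟨(x.1 1 : A), ?_⟩
    change (iotaM G A).hom (x.1 1) = x
    refine Subtype.ext (funext fun z => ?_)
    rw [iotaM_apply, F_apply G A x z]
    have := const_of A (fun n => x.1 (Multiplicative.ofAdd n, 1)) (fun n => by
      have h2 := gM_apply G A x (Multiplicative.ofAdd n, 1)
      rw [hx] at h2
      have h3 := sub_eq_zero.1 h2.symm
      simpa [tm] using h3) z.1.toAdd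
    exact this.symm
  mono_f := by
    refine (Rep.mono_iff_injective _).2 fun (x : A) (y : A) h => ?_
    exact congrFun (congrArg Subtype.val h) 1
  epi_g := by
    refine (Rep.epi_iff_surjective _).2 fun (y : F G A) => ?_
    obtain ⟨x, hx⟩ := exists_sum A (fun n => y.1 (Multiplicative.ofAdd n, 1))
    let x' : F G A := ⟨fun z => x z.1.toAdd, fun g h => by simp⟩
    refine ⟨x', ?_⟩
    change (gM G A).hom x' = y
    refine Subtype.ext (funext fun z => ?_)
    rw [gM_apply, F_apply G A y z]
    exact hx z.1.toAdd

open groupCohomology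

abbrev S (n : ℕ) : groupCohomology (F G A) n ⟶ groupCohomology (Rep.trivial ℤ G A) n :=
  groupCohomology.map (MonoidHom.inr Zm G) (counitMap (MonoidHom.inr Zm G) (Rep.trivial ℤ G A)) n

instance (n : ℕ) : IsIso (S G A n) := shapiro _ _ n

abbrev infl (n : ℕ) : groupCohomology (Rep.trivial ℤ G A) n ⟶ groupCohomology (Rep.trivial ℤ (Zm × G) A) n :=
  groupCohomology.map (A := Rep.trivial ℤ G A) (B := Rep.trivial ℤ (Zm × G) A) (MonoidHom.snd Zm G) (𝟙 (Rep.trivial ℤ (Zm × G) A)) n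

abbrev iota (n : ℕ) : groupCohomology (Rep.trivial ℤ (Zm × G) A) n ⟶ groupCohomology (F G A) n :=
  groupCohomology.map (MonoidHom.id _) (iotaM G A) n

abbrev gg (n : ℕ) : groupCohomology (F G A) n ⟶ groupCohomology (F G A) n :=
  groupCohomology.map (MonoidHom.id _) (gM G A) n

lemma comp_id (n : ℕ) : infl G A n ≫ iota G A n ≫ S G A n = 𝟙 _ := by
  have h : cochainsMap (A := Rep.trivial ℤ G A) (B := Rep.trivial ℤ (Zm × G) A) (MonoidHom.snd Zm G) (𝟙 (Rep.trivial ℤ (Zm × G) A)) ≫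
    cochainsMap (MonoidHom.id _) (iotaM G A) ≫ 
    cochainsMap (MonoidHom.inr Zm G) (counitMap (MonoidHom.inr Zm G) (Rep.trivial ℤ G A)) = 𝟙 _ := by
    rfl
  have := congrArg (fun f => HomologicalComplex.homologyMap f n) h
  simp only [HomologicalComplex.homologyMap_comp, HomologicalComplex.homologyMap_id] at this
  exact this

lemma epi_iota (n : ℕ) : Epi (iota G A n) := by
  have : (S G A n ≫ infl G A n) ≫ iota G A n = 𝟙 _ := by
    rw [← cancel_mono (S G A n)]
    simp only [Category.assoc, comp_id, Category.comp_id, Category.id_comp]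
  exact (SplitEpi.mk _ this).epi

lemma gg_zero (n : ℕ) : gg G A n = 0 := by
  have := epi_iota G A n
  rw [← cancel_epi (iota G A n), comp_zero]
  exact (mapShortComplex₂ (X G A) n).zero

abbrev del (n : ℕ) : groupCohomology (F G A) n ⟶ groupCohomology (Rep.trivial ℤ (Zm × G) A) (n+1) :=
  δ (hX G A) n (n+1) rfl

lemma del_inj (n : ℕ) : Function.Injective (del G A n) := by
  rw [← ModuleCat.mono_iff_injective]
  exact (mapShortComplex₃_exact (hX G A) (i := n) rfl).mono_g (gg_zero G A n)

lemma del_exact (n : ℕ) (x : groupCohomology (Rep.trivial ℤ (Zm × G) A) (n+1)) (hx : iota G A (n+1) x = 0) :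
    ∃ y, del G A n y = x :=
  ((ShortComplex.moduleCat_exact_iff _).1 (mapShortComplex₁_exact (hX G A) (i := n) rfl)) x hx

lemma del_zero (n : ℕ) (y) : iota G A (n+1) (del G A n y) = 0 := 
  ConcreteCategory.congr_hom (mapShortComplex₁ (hX G A) (i := n) rfl).zero y

lemma main (n : ℕ) : Nonempty (groupCohomology (Rep.trivial ℤ (Zm × G) A) (n+1) ≃+
      groupCohomology (Rep.trivial ℤ G A) n × groupCohomology (Rep.trivial ℤ G A) (n+1)) := by
  let f : groupCohomology (F G A) n × groupCohomology (Rep.trivial ℤ G A) (n+1) →+ 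
    groupCohomology (Rep.trivial ℤ (Zm × G) A) (n+1) :=
    AddMonoidHom.coprod (del G A n).hom.toAddMonoidHom (infl G A (n+1)).hom.toAddMonoidHom
  have hf (a b) : f (a, b) = del G A n a + infl G A (n+1) b := rfl
  have hs (b) : S G A (n+1) (iota G A (n+1) (infl G A (n+1) b)) = b := 
    ConcreteCategory.congr_hom (comp_id G A (n+1)) b
  have hS : Function.Injective (S G A (n+1)) := 
    (ModuleCat.mono_iff_injective _).1 inferInstance
  have bij : Function.Bijective f := by
    constructor
    · rw [injective_iff_map_eq_zero]
      rintro ⟨a, b⟩ h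
      rw [hf] at h
      have hb : b = 0 := by
        rw [← hs b]
        have := congrArg (iota G A (n+1)) h
        rw [map_add, del_zero, zero_add, map_zero] at this
        rw [this, map_zero]
      subst hb
      rw [map_zero, add_zero] at h
      have ha : a = 0 := del_inj G A n (h.trans (map_zero _).symm)
      rw [ha]; rfl
    · intro x
      obtain ⟨y, hy⟩ := del_exact G A n (x - infl G A (n+1) (S G A (n+1) (iota G A (n+1) x))) (by
        apply hS
        rw [map_sub, map_sub, hs, sub_self, map_zero])
      exact ⟨(y, S G A (n+1) (iota G A (n+1) x)), by rw [hf, hy, sub_add_cancel]⟩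
  exact ⟨(AddEquiv.ofBijective f bij).symm.trans
    (AddEquiv.prodCongr (asIso (S G A n)).toLinearEquiv.toAddEquiv (AddEquiv.refl _))⟩

end Final
end KunnethAux
end

theorem groupCohomology_int_prod_iso (G : Type) [Group G] (A : Type) [AddCommGroup A]
    (d : ℕ) (hd : 1 ≤ d) :
    Nonempty (groupCohomology (Rep.trivial ℤ (Multiplicative ℤ × G) A) d ≃+
      groupCohomology (Rep.trivial ℤ G A) (d - 1) × groupCohomology (Rep.trivial ℤ G A) d) := by
  obtain ⟨n, rfl⟩ : ∃ n, d = n + 1 := ⟨d - 1, by omega⟩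
  exact KunnethAux.main G A n
end

section
/- For every group G, every abelian group A regarded as a trivial module, and all natural numbers n and d, there is an isomorphism of abelian groups H^d(ℤ^n × G; A) ≅ ⊕_{k=0}^{d} (H^{d-k}(G; A))^{⊕ C(n,k)}, where ℤ^n is the free abelian group of rank n, C(n,k) denotes the binomial coefficient (so C(n,k) = 0 for k > n), and (M)^{⊕ m} denotes the direct sum of m copies of M. (This is the hierarchy of one strong and C(n,k) weak topological indices in codimension k, specialized to ordinary group cohomology.) -/
noncomputable section ZnAuxSection

open CategoryTheory Rep
namespace ZnAux

variable (k : Type) [CommRing k] {Γ : Type} [Group Γ]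

/-- map of bar complexes induced by endomorphism -/
def barE (e : Γ →* Γ) (n : ℕ) :
    free k Γ (Fin n → Γ) ⟶ res e (free k Γ (Fin n → Γ)) :=
  freeLift k Γ (res e (free k Γ (Fin n → Γ))) fun g => Finsupp.single (e ∘ g) (MonoidAlgebra.single 1 1)

lemma barE_single (e : Γ →* Γ) (n : ℕ) (g : Fin n → Γ) (x : Γ) (r : k) :
    (barE k e n).hom (Finsupp.single g (MonoidAlgebra.single x r)) =
      Finsupp.single (e ∘ g) (MonoidAlgebra.single (e x) r) := by
  simp [barE]

lemma barE_comm (e : Γ →* Γ) (n : ℕ) :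
    barComplex.d k Γ n ≫ barE k e n = barE k e (n+1) ≫ (resFunctor e).map (barComplex.d k Γ n) := by
  apply free_ext
  intro g
  change (barE k e n).hom ((barComplex.d k Γ n).hom _) = (barComplex.d k Γ n).hom ((barE k e (n+1)).hom _)
  rw [barE_single, barComplex.d_single, map_one, barComplex.d_single, map_add, map_sum, barE_single]
  congr 1
  refine Finset.sum_congr rfl fun j _ => ?_
  rw [barE_single, map_one, Fin.comp_contractNth]
  intro x y; simp

lemma barE_aug (e : Γ →* Γ) (p : free k Γ (Fin 0 → Γ) ⟶ trivial k Γ k) :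
    barE k e 0 ≫ (resFunctor e).map p = p := by
  apply free_ext
  intro g
  change p.hom ((barE k e 0).hom _) = p.hom _
  rw [barE_single, Subsingleton.elim (e ∘ g) g, map_one]

variable (S : Subgroup Γ) (e : Γ →* Γ) (he : ∀ s ∈ S, e s = s)

/-- An `e`-semilinear morphism is linear over a subgroup fixed by `e`. -/
def homS {X Y : Rep.{0} k Γ} (f : X ⟶ res e Y) : res S.subtype X ⟶ res S.subtype Y :=
  Rep.ofHom ⟨f.hom.toLinearMap, fun s => by
    ext x
    have := (Rep.hom_comm_apply f s.1 x)
    have h2 : (res e Y).ρ s.1 = Y.ρ s.1 := congrArg Y.ρ (he s.1 s.2)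
    rw [h2] at this
    exact this⟩

/-- The action of `e` on the restricted bar complex. -/
def barES (n : ℕ) : res S.subtype (free k Γ (Fin n → Γ)) ⟶ res S.subtype (free k Γ (Fin n → Γ)) :=
  homS k S e he (barE k e n)

lemma barES_comm (n : ℕ) : barES k S e he (n+1) ≫ (resFunctor S.subtype).map (barComplex.d k Γ n) =
    (resFunctor S.subtype).map (barComplex.d k Γ n) ≫ barES k S e he n := by
  apply Rep.hom_ext
  ext1
  exact congrArg (fun f => f.hom.toLinearMap) (barE_comm k e n).symm

/-- the chain map -/
def barESChain : ((resFunctor S.subtype).mapHomologicalComplex _).obj (barComplex k Γ) ⟶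
    ((resFunctor S.subtype).mapHomologicalComplex _).obj (barComplex k Γ) where
  f n := barES k S e he n
  comm' i j hij := by
    obtain rfl : j + 1 = i := hij
    rw [Functor.mapHomologicalComplex_obj_d, barComplex.d_def]
    exact barES_comm k S e he j

lemma barES_aug (p : free k Γ (Fin 0 → Γ) ⟶ trivial k Γ k) :
    barES k S e he 0 ≫ (resFunctor S.subtype).map p = (resFunctor S.subtype).map p := by
  apply Rep.hom_ext
  ext1
  exact congrArg (fun f => f.hom.toLinearMap) (barE_aug k e p)

lemma barESChain_π : barESChain k S e he ≫ ((resFunctor S.subtype).mapHomologicalComplex _).map (barResolution k Γ).π =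
   ((resFunctor S.subtype).mapHomologicalComplex _).map (barResolution k Γ).π := by
  ext n : 1
  cases n with
  | zero => exact barES_aug k S e he ((barResolution k Γ).π.f 0)
  | succ n =>
    apply Limits.IsZero.eq_of_tgt
    refine Functor.map_isZero (resFunctor S.subtype) ?_
    exact HomologicalComplex.isZero_single_obj_X _ _ _ _ (by simp)

def barHomotopy : Homotopy (𝟙 _) (barESChain k S e he) :=
  ProjectiveResolution.liftHomotopy (𝟙 _)
    (P := (resFunctor S.subtype).mapProjectiveResolution (barResolution k Γ))
    (Q := (resFunctor S.subtype).mapProjectiveResolution (barResolution k Γ))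
    (𝟙 _) (barESChain k S e he) ((Category.id_comp _).trans (by erw [CategoryTheory.Functor.map_id, Category.comp_id])) (by
      erw [CategoryTheory.Functor.map_id, Category.comp_id]
      dsimp only [Functor.mapProjectiveResolution]
      exact (Category.assoc _ _ _).symm.trans (congrArg (· ≫ _) (barESChain_π k S e he)))

include he in
theorem exists_homotopy : ∃ h : ∀ n : ℕ, ((Fin n → Γ) →₀ MonoidAlgebra k Γ) →ₗ[k] ((Fin (n+1) → Γ) →₀ MonoidAlgebra k Γ),
    (∀ n, ∀ s ∈ S, ∀ x, h n (Representation.free k Γ _ s x) = Representation.free k Γ _ s (h n x)) ∧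
    (∀ x, x = (barComplex.d k Γ 0).hom (h 0 x) + (barE k e 0).hom x) ∧
    (∀ n x, x = h n ((barComplex.d k Γ n).hom x) + (barComplex.d k Γ (n+1)).hom (h (n+1) x) + (barE k e (n+1)).hom x) := by
  let H := barHomotopy k S e he
  refine ⟨fun n => (H.hom n (n+1)).hom.toLinearMap, fun n s hs x => ?_, fun x => ?_, fun n x => ?_⟩
  · exact LinearMap.congr_fun ((H.hom n (n+1)).hom.isIntertwining' ⟨s, hs⟩) x
  · have := H.comm 0
    rw [Homotopy.dNext_zero_chainComplex, Homotopy.prevD_chainComplex,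
      Functor.mapHomologicalComplex_obj_d, barComplex.d_def, zero_add] at this
    exact congrArg (fun f => f.hom.toLinearMap x) this
  · have := H.comm (n+1)
    rw [Homotopy.dNext_succ_chainComplex, Homotopy.prevD_chainComplex,
      Functor.mapHomologicalComplex_obj_d, Functor.mapHomologicalComplex_obj_d, barComplex.d_def, barComplex.d_def] at this
    exact congrArg (fun f => f.hom.toLinearMap x) this


section coch

variable {k}

lemma freeLift_d (M : Rep.{0} k Γ) (n : ℕ) (f : (Fin n → Γ) → M) :
    freeLift k Γ M ((inhomogeneousCochains.d M n).hom f) = barComplex.d k Γ n ≫ freeLift k Γ M f := by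
  apply free_ext
  intro g
  change Representation.freeLift M.ρ _ _ = Representation.freeLift M.ρ f ((barComplex.d k Γ n).hom _)
  rw [barComplex.d_single, map_add, map_sum, Representation.freeLift_single_single,
    Representation.freeLift_single_single, map_one, one_smul, one_smul]
  simp only [Representation.freeLift_single_single, map_one]
  rfl

variable {G : Type} [Group G] (A : Type) [AddCommGroup A] [Module k A]

/-- Functions on `ℤ`, with translation action. -/
def MRho : Representation k (Multiplicative ℤ × G) (ℤ → A) where
  toFun x := LinearMap.funLeft k A (fun m => m + x.1.toAdd)
  map_one' := by ext; simp [LinearMap.funLeft]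
  map_mul' x y := by
    ext u m
    simp only [LinearMap.funLeft_apply, Module.End.mul_apply, Prod.fst_mul, toAdd_mul]
    congr 1
    ring

variable (k G) in
/-- Functions on `ℤ`, with translation action. -/
abbrev MRep : Rep.{0} k (Multiplicative ℤ × G) := Rep.of (MRho (k := k) (G := G) A)

/-- the linear form on the bar resolution attached to a cochain -/
def Phi {n : ℕ} (f : (Fin n → Multiplicative ℤ × G) → ℤ → A) :
    ((Fin n → Multiplicative ℤ × G) →₀ MonoidAlgebra k (Multiplicative ℤ × G)) →ₗ[k] A :=
  LinearMap.proj 0 ∘ₗ (Representation.freeLift (MRho (k := k) (G := G) A) f).toLinearMap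

lemma Phi_single {n : ℕ} (f : (Fin n → Multiplicative ℤ × G) → ℤ → A) (g) (x) (r : k) :
    Phi A f (Finsupp.single g (MonoidAlgebra.single x r)) = r • f g x.1.toAdd := by
  change (Representation.freeLift (MRho (k := k) (G := G) A) f _) 0 = _
  rw [Representation.freeLift_single_single]
  simp [MRho]

lemma Phi_d {n : ℕ} (f : (Fin n → Multiplicative ℤ × G) → ℤ → A) (x) :
    Phi A ((inhomogeneousCochains.d (MRep k G A) n).hom f) x =
      Phi (k := k) A f ((barComplex.d k (Multiplicative ℤ × G) n).hom x) := by
  have := congrArg (fun F => F.hom.toLinearMap x) (freeLift_d (MRep k G A) n f)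
  exact congrFun this 0

lemma Phi_S {n : ℕ} (f : (Fin n → Multiplicative ℤ × G) → ℤ → A) (s : Multiplicative ℤ × G)
    (hs : s.1 = 1) (x) :
    Phi (k := k) A f (Representation.free k _ _ s x) = Phi (k := k) A f x := by
  have := LinearMap.congr_fun
    ((Representation.freeLift (MRho (k := k) (G := G) A) f).isIntertwining' s) x
  refine (congrFun this 0).trans ?_
  change (Representation.freeLift (MRho (k := k) (G := G) A) f x) (0 + s.1.toAdd) = _
  rw [hs]
  rfl

variable (G) in
/-- the idempotent endomorphism -/
def eZ : Multiplicative ℤ × G →* Multiplicative ℤ × G :=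
  (MonoidHom.inr (Multiplicative ℤ) G).comp (MonoidHom.snd _ _)

lemma Phi_E {n : ℕ} (f : (Fin n → Multiplicative ℤ × G) → ℤ → A) (g) (x) :
    Phi A f ((barE k (eZ G) n).hom (Finsupp.single g (MonoidAlgebra.single x 1))) =
      f (eZ G ∘ g) 0 := by
  rw [barE_single]
  refine (Phi_single A f _ _ _).trans ?_
  rw [one_smul]; rfl

lemma exists_cobounding_zero (f : (Fin 0 → Multiplicative ℤ × G) → ℤ → A)
    (hf : (inhomogeneousCochains.d (MRep k G A) 0).hom f = 0) (g m) :
    f g m = f (eZ G ∘ g) 0 := by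
  obtain ⟨h, -, h0, -⟩ := exists_homotopy k (MonoidHom.fst (Multiplicative ℤ) G).ker (eZ G) (by
    rintro ⟨a, b⟩ hs
    obtain rfl : a = 1 := hs
    rfl)
  have := congrArg (Phi (k := k) A f)
    (h0 (Finsupp.single g (MonoidAlgebra.single (Multiplicative.ofAdd m, 1) 1)))
  rw [map_add, Phi_E, ← Phi_d, hf, Phi_single, one_smul] at this
  refine this.trans ?_
  have z : Phi (k := k) A (0 : (Fin 1 → Multiplicative ℤ × G) → ℤ → A) = 0 := by
    ext; simp [Phi_single]
  erw [z]
  simp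

lemma exists_cobounding_succ (n : ℕ) (f : (Fin (n+1) → Multiplicative ℤ × G) → ℤ → A)
    (hf : (inhomogeneousCochains.d (MRep k G A) (n+1)).hom f = 0) :
    ∃ y : (Fin n → Multiplicative ℤ × G) → ℤ → A, ∀ g m,
    f g m = (inhomogeneousCochains.d (MRep k G A) n).hom y g m + f (eZ G ∘ g) 0 := by
  obtain ⟨h, hS, -, h1⟩ := exists_homotopy k (MonoidHom.fst (Multiplicative ℤ) G).ker (eZ G) (by
    rintro ⟨a, b⟩ hs
    obtain rfl : a = 1 := hs
    rfl)
  let y : (Fin n → Multiplicative ℤ × G) → ℤ → A := fun g m =>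
    Phi (k := k) A f (h n (Finsupp.single g (MonoidAlgebra.single (Multiplicative.ofAdd m, 1) 1)))
  have hy : ∀ x, Phi (k := k) A f (h n x) = Phi (k := k) A y x := by
    intro x
    refine LinearMap.congr_fun (f := Phi (k := k) A f ∘ₗ h n) (g := Phi (k := k) A y) ?_ x
    apply Finsupp.lhom_ext'
    intro g
    apply MonoidAlgebra.lhom_ext'
    rintro ⟨m, u⟩
    apply LinearMap.ext_ring
    change Phi (k := k) A f (h n (Finsupp.single g (MonoidAlgebra.single (m, u) 1))) =
      Phi (k := k) A y (Finsupp.single g (MonoidAlgebra.single (m, u) 1))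
    rw [Phi_single, one_smul]
    have e1 : (Finsupp.single g (MonoidAlgebra.single (m, u) (1 : k))) =
      Representation.free k _ _ ((1, u) : Multiplicative ℤ × G)
        (Finsupp.single g (MonoidAlgebra.single (m, 1) 1)) := by simp
    rw [e1, hS n (1, u) rfl, Phi_S _ _ _ rfl]
    rfl
  refine ⟨y, fun g m => ?_⟩
  have := congrArg (Phi (k := k) A f)
    (h1 n (Finsupp.single g (MonoidAlgebra.single (Multiplicative.ofAdd m, 1) 1)))
  rw [map_add, map_add, Phi_E, ← Phi_d, hf, hy, ← Phi_d, Phi_single, one_smul, Phi_single, one_smul] at this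
  refine this.trans ?_
  have z : Phi (k := k) A (0 : (Fin (n+2) → Multiplicative ℤ × G) → ℤ → A) = 0 := by
    ext; simp [Phi_single]
  erw [z]
  simp

/-- evaluation at zero as an endomorphism -/
def psi : res (eZ G) (MRep k G A) ⟶ MRep k G A :=
  Rep.ofHom ⟨LinearMap.pi fun _ => LinearMap.proj 0, fun x => by
    ext u m
    simp [MRho, eZ]⟩

lemma psi_cochain (n : ℕ) (f : (Fin n → Multiplicative ℤ × G) → ℤ → A) (g) (m) :
    ((groupCohomology.cochainsMap (eZ G) (psi (k := k) (G := G) A)).f n).hom f g m = f (eZ G ∘ g) 0 := rfl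

open groupCohomology in
theorem map_psi (n : ℕ) : groupCohomology.map (eZ G) (psi (k := k) (G := G) A) n = 𝟙 _ := by
  ext x
  induction x using groupCohomology_induction_on with | _ z =>
  have hinj : Function.Injective (iCocycles (MRep k G A) n).hom :=
    (ModuleCat.mono_iff_injective _).1 inferInstance
  let f : (Fin n → Multiplicative ℤ × G) → ℤ → A := (iCocycles (MRep k G A) n).hom z
  have hf : (inhomogeneousCochains.d (MRep k G A) n).hom f = 0 := by
    have := (inhomogeneousCochains (MRep k G A)).iCycles_d n (n+1)
    rw [inhomogeneousCochains.d_def] at this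
    exact congrArg (fun F => F.hom z) this
  have h1 : ∀ z, (groupCohomology.map (eZ G) (psi (k := k) (G := G) A) n).hom ((π (MRep k G A) n).hom z) =
      (π (MRep k G A) n).hom ((cocyclesMap (eZ G) (psi (k := k) (G := G) A) n).hom z) := fun z =>
    congrArg (fun F => F.hom z) (π_map (eZ G) (psi (k := k) (G := G) A) n)
  have h2 : (iCocycles (MRep k G A) n).hom ((cocyclesMap (eZ G) (psi (k := k) (G := G) A) n).hom z) =
      ((cochainsMap (eZ G) (psi (k := k) (G := G) A)).f n).hom f :=
    congrArg (fun F => F.hom z) (HomologicalComplex.cyclesMap_i (cochainsMap (eZ G) (psi (k := k) (G := G) A)) n)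
  refine (h1 z).trans ?_
  change _ = (π (MRep k G A) n).hom z
  cases n with
  | zero =>
    congr 1
    apply hinj
    rw [h2]
    funext g m
    exact (exists_cobounding_zero A f hf g m).symm
  | succ n =>
    obtain ⟨y, hy⟩ := exists_cobounding_succ A n f hf
    have h3 : z = (toCocycles (MRep k G A) n (n+1)).hom y +
        (cocyclesMap (eZ G) (psi (k := k) (G := G) A) (n+1)).hom z := by
      apply hinj
      rw [map_add, h2]
      have h4 : (iCocycles (MRep k G A) (n+1)).hom ((toCocycles (MRep k G A) n (n+1)).hom y) =
          (inhomogeneousCochains.d (MRep k G A) n).hom y := by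
        rw [← inhomogeneousCochains.d_def]
        exact congrArg (fun F => F.hom y) ((inhomogeneousCochains (MRep k G A)).toCycles_i n (n+1))
      rw [h4]
      funext g m
      exact hy g m
    have h5 : (π (MRep k G A) (n+1)).hom ((toCocycles (MRep k G A) n (n+1)).hom y) = 0 :=
      congrArg (fun F => F.hom y) ((inhomogeneousCochains (MRep k G A)).toCycles_comp_homologyπ n (n+1))
    conv_rhs => rw [h3]
    rw [map_add, h5, zero_add]

end coch

section step

variable {k} (G : Type) [Group G] (A : Type) [AddCommGroup A] [Module k A]

variable (k) in
/-- constants -/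
def cMap : Rep.trivial k (Multiplicative ℤ × G) A ⟶ MRep k G A :=
  Rep.ofHom ⟨LinearMap.pi fun _ => LinearMap.id, fun x => by
    ext u m
    simp [MRho]⟩

variable (k) in
/-- difference operator -/
def dMap : MRep k G A ⟶ MRep k G A :=
  Rep.ofHom ⟨LinearMap.funLeft k A (fun m => m + 1) - LinearMap.id, fun x => by
    ext u m
    simp [MRho, LinearMap.funLeft_apply, add_right_comm]⟩

lemma dMap_surj : Function.Surjective (fun (u : ℤ → A) (m : ℤ) => u (m + 1) - u m) := by
  intro v
  let u : ℤ → A := fun m => match m with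
    | .ofNat n => ∑ i ∈ Finset.range n, v i
    | .negSucc n => - ∑ i ∈ Finset.range (n+1), v (Int.negSucc i)
  refine ⟨u, funext fun m => ?_⟩
  match m with
  | .ofNat n =>
    change (∑ i ∈ Finset.range (n+1), v i) - ∑ i ∈ Finset.range n, v i = v n
    rw [Finset.sum_range_succ, add_sub_cancel_left]
  | .negSucc 0 =>
    change (∑ i ∈ Finset.range 0, v i) - - ∑ i ∈ Finset.range (0+1), v (Int.negSucc i) = _
    simp
  | .negSucc (n+1) =>
    change (- ∑ i ∈ Finset.range (n+1), v (Int.negSucc i)) -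
      - ∑ i ∈ Finset.range (n+1+1), v (Int.negSucc i) = _
    rw [Finset.sum_range_succ _ (n+1)]
    abel

variable (k) in
/-- The short complex `A ⟶ Fun(ℤ, A) ⟶ Fun(ℤ, A)`. -/
def sc : ShortComplex (Rep.{0} k (Multiplicative ℤ × G)) where
  X₁ := Rep.trivial k (Multiplicative ℤ × G) A
  X₂ := MRep k G A
  X₃ := MRep k G A
  f := cMap k G A
  g := dMap k G A
  zero := by
    apply Rep.hom_ext
    ext u m
    exact sub_self _

lemma sc_shortExact : (sc k G A).ShortExact where
  exact := by
    rw [← ShortComplex.exact_map_iff_of_faithful _ (forget₂ (Rep.{0} k (Multiplicative ℤ × G)) (ModuleCat k)),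
      ShortComplex.moduleCat_exact_iff]
    intro (u : ℤ → A) hu
    have hu' : ∀ m, u (m + 1) = u m := fun m => sub_eq_zero.1 (congrFun hu m)
    refine ⟨u 0, funext fun m => ?_⟩
    change u 0 = u m
    induction m using Int.induction_on with
    | zero => rfl
    | succ i ih => rw [hu', ih]
    | pred i ih => rw [ih, ← hu' (-(i:ℤ) - 1), sub_add_cancel]
  mono_f := (Rep.mono_iff_injective _).2 fun a b h => congrFun h 0
  epi_g := (Rep.epi_iff_surjective _).2 (dMap_surj A)

variable (k) in
/-- evaluation at zero -/
def evMap : res (MonoidHom.inr (Multiplicative ℤ) G) (MRep k G A) ⟶ Rep.trivial k G A :=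
  Rep.ofHom ⟨LinearMap.proj 0, fun x => by
    ext u
    simp [MRho]⟩

variable (k) in
/-- inflation -/
def inflMap : res (MonoidHom.snd (Multiplicative ℤ) G) (Rep.trivial k G A) ⟶
    Rep.trivial k (Multiplicative ℤ × G) A :=
  Rep.ofHom ⟨LinearMap.id, fun x => by ext u; simp⟩

open groupCohomology

variable (k) in
/-- restriction to `G` -/
abbrev evH (n : ℕ) : groupCohomology (MRep k G A) n ⟶ groupCohomology (Rep.trivial k G A) n :=
  groupCohomology.map (MonoidHom.inr (Multiplicative ℤ) G) (evMap k G A) n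

variable (k) in
/-- inflation from `G` -/
abbrev inflH (n : ℕ) : groupCohomology (Rep.trivial k G A) n ⟶
    groupCohomology (Rep.trivial k (Multiplicative ℤ × G) A) n :=
  groupCohomology.map (MonoidHom.snd (Multiplicative ℤ) G) (inflMap k G A) n

variable (k) in
/-- constants on cohomology -/
abbrev cH (n : ℕ) : groupCohomology (Rep.trivial k (Multiplicative ℤ × G) A) n ⟶
    groupCohomology (MRep k G A) n :=
  groupCohomology.map (MonoidHom.id _) (cMap k G A) n

lemma ev_infl_c (n : ℕ) : evH k G A n ≫ inflH k G A n ≫ cH k G A n = 𝟙 _ := by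
  rw [← map_psi (k := k) (G := G) A n, ← map_comp, ← map_comp]
  exact map_congr rfl rfl n

lemma infl_c_ev (n : ℕ) : inflH k G A n ≫ cH k G A n ≫ evH k G A n = 𝟙 _ := by
  rw [← map_id, ← map_comp, ← map_comp]
  exact map_congr rfl rfl n

variable (k) in
/-- difference operator on cohomology -/
abbrev dH (n : ℕ) : groupCohomology (MRep k G A) n ⟶ groupCohomology (MRep k G A) n :=
  groupCohomology.map (A := MRep k G A) (B := MRep k G A)
    (MonoidHom.id (Multiplicative ℤ × G)) (dMap k G A) n

lemma dH_zero (n : ℕ) (x : groupCohomology (MRep k G A) n) : (dH k G A n).hom x = 0 := by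
  have h1 : cH k G A n ≫ dH k G A n = 0 := (mapShortComplex₂ (sc k G A) n).zero
  have h2 : dH k G A n = 0 := by
    rw [← Category.id_comp (dH k G A n), ← ev_infl_c]
    simp only [Category.assoc, h1, Limits.comp_zero]
  rw [h2]; rfl

/-- the equivalence H^n(Γ, M) ≃ H^n(G, A) -/
def shapiro (n : ℕ) : groupCohomology (MRep k G A) n ≃+ groupCohomology (Rep.trivial k G A) n :=
  AddMonoidHom.toAddEquiv (evH k G A n).hom.toAddMonoidHom
    (inflH k G A n ≫ cH k G A n).hom.toAddMonoidHom
    (by ext x; exact congrArg (fun F => F.hom x) (ev_infl_c G A n))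
    (by ext x; exact congrArg (fun F => F.hom x) (infl_c_ev G A n))

theorem step_succ (n : ℕ) : Nonempty (groupCohomology (Rep.trivial k (Multiplicative ℤ × G) A) (n+1) ≃+
    groupCohomology (Rep.trivial k G A) (n+1) × groupCohomology (Rep.trivial k G A) n) := by
  let D : groupCohomology (MRep k G A) n ⟶
      groupCohomology (Rep.trivial k (Multiplicative ℤ × G) A) (n+1) := δ (sc_shortExact (k := k) G A) n (n+1) rfl
  let s := (evH k G A (n+1) ≫ inflH k G A (n+1))
  have hs : ∀ x, (cH k G A (n+1)).hom (s.hom x) = x := fun x =>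
    congrArg (fun F => F.hom x) (ev_infl_c (k := k) G A (n+1))
  have hD : ∀ x, (cH k G A (n+1)).hom (D.hom x) = 0 := fun x =>
    congrArg (fun F => F.hom x) (mapShortComplex₁ (sc_shortExact (k := k) G A) (i := n) rfl).zero
  have hDinj : ∀ x, D.hom x = 0 → x = 0 := by
    intro x hx
    obtain ⟨y, hy⟩ := (ShortComplex.moduleCat_exact_iff _).1
      (mapShortComplex₃_exact (sc_shortExact (k := k) G A) (i := n) rfl) x hx
    exact hy.symm.trans (dH_zero G A n y)
  have hex : ∀ x, (cH k G A (n+1)).hom x = 0 → ∃ y, D.hom y = x := fun x hx =>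
    (ShortComplex.moduleCat_exact_iff _).1
      (mapShortComplex₁_exact (sc_shortExact (k := k) G A) (i := n) rfl) x hx
  let F : groupCohomology (MRep k G A) (n+1) × groupCohomology (MRep k G A) n →+
      groupCohomology (Rep.trivial k (Multiplicative ℤ × G) A) (n+1) :=
    AddMonoidHom.coprod s.hom.toAddMonoidHom D.hom.toAddMonoidHom
  have hF : ∀ x, F x = s.hom x.1 + D.hom x.2 := fun x => rfl
  have hbij : Function.Bijective F := by
    constructor
    · rw [injective_iff_map_eq_zero]
      rintro ⟨a, b⟩ h
      rw [hF] at h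
      have ha : a = 0 := by
        have := congrArg (cH k G A (n+1)).hom h
        rw [map_add, hs, hD, add_zero, map_zero] at this
        exact this
      subst ha
      rw [map_zero, zero_add] at h
      rw [hDinj b h]
      rfl
    · intro x
      obtain ⟨y, hy⟩ := hex (x - s.hom ((cH k G A (n+1)).hom x)) (by rw [map_sub, hs, sub_self])
      exact ⟨((cH k G A (n+1)).hom x, y), by rw [hF, hy]; abel⟩
  exact ⟨(AddEquiv.ofBijective F hbij).symm.trans
    ((shapiro G A (n+1)).prodCongr (shapiro G A n))⟩

theorem step_zero (Γ' : Type) [Group Γ'] :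
    Nonempty (groupCohomology (Rep.trivial k Γ' A) 0 ≃+ groupCohomology (Rep.trivial k G A) 0) :=
  ⟨((H0IsoOfIsTrivial (Rep.trivial k Γ' A)).toLinearEquiv.trans
    (H0IsoOfIsTrivial (Rep.trivial k G A)).toLinearEquiv.symm).toAddEquiv⟩

theorem congr_group {G' : Type} [Group G'] (e : G ≃* G') (n : ℕ) :
    Nonempty (groupCohomology (Rep.trivial k G A) n ≃+ groupCohomology (Rep.trivial k G' A) n) :=
  ⟨(mapIso (B := Rep.trivial k G A) (A := Rep.trivial k G' A) e (LinearEquiv.refl k A)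
    (fun g => by ext; simp) n).toLinearEquiv.toAddEquiv⟩

end step

section comb

variable (H : ℕ → Type) [∀ n, AddCommGroup (H n)]

/-- The right hand side. -/
abbrev Y (n d : ℕ) : Type := (k : Fin (d + 1)) → Fin (n.choose k) → H (d - k)

/-- Splitting off the first coordinate. -/
def consAdd (m : ℕ) (B : Fin (m+1) → Type) [∀ i, AddCommGroup (B i)] :
    ((i : Fin (m+1)) → B i) ≃+ B 0 × ((j : Fin m) → B j.succ) where
  toFun f := (f 0, fun j => f j.succ)
  invFun p := Fin.cons p.1 p.2
  left_inv f := by funext i; refine Fin.cases ?_ (fun j => ?_) i <;> simp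
  right_inv p := by simp
  map_add' _ _ := rfl

/-- A product of products. -/
def piProd (m : ℕ) (B C : Fin m → Type) [∀ i, AddCommGroup (B i)] [∀ i, AddCommGroup (C i)] :
    ((i : Fin m) → B i × C i) ≃+ ((i : Fin m) → B i) × ((i : Fin m) → C i) where
  toFun f := (fun i => (f i).1, fun i => (f i).2)
  invFun p := fun i => (p.1 i, p.2 i)
  left_inv _ := rfl
  right_inv _ := rfl
  map_add' _ _ := rfl

theorem copies_eq {a b c d : ℕ} (h : a = b) (h' : c = d) :
    Nonempty ((Fin a → H c) ≃+ (Fin b → H d)) := by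
  subst h h'
  exact ⟨AddEquiv.refl _⟩

theorem Y_zero_right (n m : ℕ) : Nonempty (Y H n 0 ≃+ Y H m 0) :=
  ⟨AddEquiv.piCongrRight fun k => (copies_eq H (by
    have : k = 0 := Fin.ext (by have := k.2; omega)
    subst this
    simp) rfl).some⟩

theorem copies_add (a b c : ℕ) (h : c = a + b) (B : Type) [AddCommGroup B] :
    Nonempty ((Fin c → B) ≃+ (Fin a → B) × (Fin b → B)) := by
  subst h
  exact ⟨{ (Fin.appendEquiv a b (α := B)).symm with
    map_add' := fun _ _ => rfl }⟩

theorem Y_zero_left (d : ℕ) : Nonempty (Y H 0 d ≃+ H d) := by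
  refine ⟨AddEquiv.ofBijective (⟨⟨fun f => f 0 ⟨0, by simp⟩, rfl⟩, fun _ _ => rfl⟩ : Y H 0 d →+ H d) ⟨?_, ?_⟩⟩
  · intro f g h
    funext k i
    refine Fin.cases ?_ (fun j => ?_) k i
    · intro i
      have : i = ⟨0, by simp⟩ := by
        apply Fin.ext
        have := i.2
        simp at this
        exact this
      rw [this]; exact h
    · intro i
      have := i.2
      simp at this
  · intro x
    refine ⟨fun k i => if h : k = 0 then cast (by rw [h]; rfl) x else 0, ?_⟩
    change (if h : (0 : Fin (d+1)) = 0 then cast (by rfl) x else 0) = x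
    rw [dif_pos rfl]
    rfl

theorem Y_succ (n d : ℕ) : Nonempty (Y H (n+1) (d+1) ≃+ Y H n (d+1) × Y H n d) := by
  let B : Fin (d+1+1) → Type := fun k => Fin ((n+1).choose k) → H (d + 1 - k)
  let B' : Fin (d+1+1) → Type := fun k => Fin (n.choose k) → H (d + 1 - k)
  let C : Fin (d+1) → Type := fun k => Fin (n.choose k) → H (d - k)
  have e0 : Nonempty (B 0 ≃+ B' 0) := copies_eq H (by simp) rfl
  have e1 : ∀ j : Fin (d+1), Nonempty (B j.succ ≃+ B' j.succ × C j) := fun j => by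
    have h : (n+1).choose j.succ = n.choose j.succ + n.choose j := by
      rw [Fin.val_succ, Nat.choose_succ_succ, add_comm]
    have f1 := (copies_add _ _ _ h (H (d + 1 - j.succ))).some
    have f2 : Nonempty ((Fin (n.choose j) → H (d + 1 - j.succ)) ≃+ C j) :=
      copies_eq H rfl (by rw [Fin.val_succ, Nat.add_sub_add_right])
    exact ⟨f1.trans ((AddEquiv.refl _).prodCongr f2.some)⟩
  let E1 : ((j : Fin (d+1)) → B j.succ) ≃+ ((j : Fin (d+1)) → B' j.succ) × ((j : Fin (d+1)) → C j) :=
    (AddEquiv.piCongrRight fun j => (e1 j).some).trans (piProd _ _ _)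
  exact ⟨(consAdd _ B).trans ((e0.some.prodCongr E1).trans
    ((AddEquiv.prodAssoc).symm.trans ((consAdd _ B').symm.prodCongr (AddEquiv.refl _))))⟩

end comb

/-- Splitting off one coordinate of the lattice. -/
def splitLattice (n : ℕ) (G : Type) [Group G] : Multiplicative (Fin (n+1) → ℤ) × G ≃*
    Multiplicative ℤ × (Multiplicative (Fin n → ℤ) × G) where
  toFun p := (Multiplicative.ofAdd (p.1.toAdd 0),
    (Multiplicative.ofAdd fun j => p.1.toAdd j.succ, p.2))
  invFun q := (Multiplicative.ofAdd (Fin.cons q.1.toAdd q.2.1.toAdd), q.2.2)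
  left_inv p := by
    refine Prod.ext ?_ rfl
    apply Multiplicative.toAdd.injective
    funext i
    refine Fin.cases ?_ (fun j => ?_) i <;> rfl
  right_inv q := rfl
  map_mul' _ _ := rfl

/-- The trivial lattice. -/
def zeroLattice (G : Type) [Group G] : Multiplicative (Fin 0 → ℤ) × G ≃* G where
  toFun p := p.2
  invFun g := (1, g)
  left_inv p := Prod.ext (Subsingleton.elim (α := Fin 0 → ℤ) _ _) rfl
  right_inv _ := rfl
  map_mul' _ _ := rfl

theorem main (G : Type) [Group G] (A : Type) [AddCommGroup A] [Module k A] (n : ℕ) : ∀ d : ℕ,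
    Nonempty (groupCohomology (Rep.trivial k (Multiplicative (Fin n → ℤ) × G) A) d ≃+
      Y (fun i => groupCohomology (Rep.trivial k G A) i) n d) := by
  induction n with
  | zero =>
    intro d
    obtain ⟨e1⟩ := congr_group (k := k) _ A (zeroLattice G) d
    obtain ⟨e2⟩ := Y_zero_left (fun i => groupCohomology (Rep.trivial k G A) i) d
    exact ⟨e1.trans e2.symm⟩
  | succ n ih =>
    intro d
    cases d with
    | zero =>
      obtain ⟨e1⟩ := step_zero (k := k) (Multiplicative (Fin n → ℤ) × G) A
        (Multiplicative (Fin (n+1) → ℤ) × G)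
      obtain ⟨e2⟩ := ih 0
      obtain ⟨e3⟩ := Y_zero_right (fun i => groupCohomology (Rep.trivial k G A) i) n (n+1)
      exact ⟨e1.trans (e2.trans e3)⟩
    | succ d =>
      obtain ⟨e1⟩ := congr_group (k := k) _ A (splitLattice n G) (d+1)
      obtain ⟨e2⟩ := step_succ (k := k) (Multiplicative (Fin n → ℤ) × G) A d
      obtain ⟨e3⟩ := ih (d+1)
      obtain ⟨e4⟩ := ih d
      obtain ⟨e5⟩ := Y_succ (fun i => groupCohomology (Rep.trivial k G A) i) n d
      exact ⟨e1.trans (e2.trans ((e3.prodCongr e4).trans e5.symm))⟩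

end ZnAux

end ZnAuxSection

/-- **Hierarchy of strong and weak topological indices**, specialized to ordinary group
cohomology: for every group `G`, abelian group `A` with the trivial action, and all natural
numbers `n` and `d`, `H^d(ℤ^n × G; A) ≅ ⊕_{k=0}^{d} (H^{d-k}(G; A))^{⊕ C(n,k)}` as abelian
groups, where `ℤ^n` is the free abelian group of rank `n` (written multiplicatively) and
`C(n,k) = Nat.choose n k` (which vanishes for `k > n`). -/
theorem groupCohomology_zn_prod_iso (G : Type) [Group G] (A : Type) [AddCommGroup A]
    (n d : ℕ) :
    Nonempty (groupCohomology (Rep.trivial ℤ (Multiplicative (Fin n → ℤ) × G) A) d ≃+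
      ((k : Fin (d + 1)) → Fin (n.choose k) → groupCohomology (Rep.trivial ℤ G A) (d - k))) := by
  exact ZnAux.main ℤ G A n d
end

section
/- For every abelian group A regarded as a trivial module and all natural numbers n and d, the group cohomology of the free abelian group ℤ^n satisfies H^d(ℤ^n; A) ≅ A^{⊕ C(n,d)}, the direct sum of C(n,d) copies of A, where C(n,d) is the binomial coefficient; in particular H^d(ℤ^n; A) = 0 for d > n. -/
open CategoryTheory Rep
open scoped TensorProduct
set_option linter.all false

namespace GCZn
variable {k G H : Type} [CommRing k] [Group G] [Group H]

noncomputable section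

/-- precomposition -/
def yonMap {X Y : ChainComplex (Rep.{0} k H) ℕ} (f : X ⟶ Y) (A : Rep.{0} k H) :
    Y.linearYonedaObj k A ⟶ X.linearYonedaObj k A :=
  (HomologicalComplex.unopFunctor _ _).map
    ((((linearYoneda k (Rep.{0} k H)).obj A).rightOp.mapHomologicalComplex _).map f).op

lemma yonMap_f {X Y : ChainComplex (Rep.{0} k H) ℕ} (f : X ⟶ Y) (A : Rep.{0} k H) (i : ℕ)
    (x : Y.X i ⟶ A) : ((yonMap f A).f i).hom x = f.f i ≫ x := rfl

lemma yonMap_quasiIso {X Y : ChainComplex (Rep.{0} k H) ℕ} (f : HomotopyEquiv X Y)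
    (A : Rep.{0} k H) : QuasiIso (yonMap f.hom A) := by
  have h : QuasiIso ((((linearYoneda k (Rep.{0} k H)).obj A).rightOp.mapHomologicalComplex _).map f.hom) := 
    inferInstanceAs <| QuasiIso
      (((linearYoneda k (Rep.{0} k H)).obj A).rightOp.mapHomotopyEquiv f).hom
  exact (HomologicalComplex.quasiIso_unopFunctor_map_iff _).2 h

/-- equiv -/
def heq {Z : Rep.{0} k H} (P Q : ProjectiveResolution Z) (f : P.complex ⟶ Q.complex)
    (hf : f ≫ Q.π = P.π) : HomotopyEquiv P.complex Q.complex where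
  hom := f
  inv := ProjectiveResolution.lift (𝟙 Z) Q P
  homotopyHomInvId := ProjectiveResolution.liftHomotopy (𝟙 Z) _ _ (by simp [hf]) (by simp)
  homotopyInvHomId := ProjectiveResolution.liftHomotopy (𝟙 Z) _ _ (by simp [hf]) (by simp)

instance : (coindFunctor k (MonoidHom.inl H G)).PreservesEpimorphisms where
  preserves {M N} f hf := by
    rw [Rep.epi_iff_surjective] at hf ⊢
    intro x
    choose σ hσ using hf
    refine ⟨⟨fun g => M.ρ g.1 (σ (x.1 (1, g.2))), fun g h => ?_⟩, ?_⟩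
    · simp
    · apply Subtype.ext
      funext g
      have := x.2 g.1 (1, g.2)
      simp at this
      change f.hom (M.ρ g.1 (σ (x.1 (1, g.2)))) = _
      rw [hom_comm_apply, hσ, ← this]

instance : (resFunctor.{0} (k := k) (MonoidHom.inl H G)).PreservesProjectiveObjects :=
  (resFunctor (MonoidHom.inl H G)).preservesProjectiveObjects_of_adjunction_of_preservesEpimorphisms
    (resCoindAdjunction k (MonoidHom.inl H G))

/-- the bar map -/
def barMap (s : H →* G) :
    barComplex k H ⟶ ((resFunctor s).mapHomologicalComplex _).obj (barComplex k G) where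
  f n := freeLift k H (res s (free k G (Fin n → G)))
    fun x => Finsupp.single (s ∘ x) (.single 1 1)
  comm' i j hij := by
    obtain rfl : j + 1 = i := hij
    rw [Functor.mapHomologicalComplex_obj_d, barComplex.d_def, barComplex.d_def]
    apply free_ext
    intro x
    change (barComplex.d k G j).hom ((freeLift k H (res s (free k G (Fin (j+1) → G)))
      fun x => Finsupp.single (s ∘ x) (.single 1 1)).hom _) = 
      (freeLift k H (res s (free k G (Fin j → G)))
      fun x => Finsupp.single (s ∘ x) (.single 1 1)).hom ((barComplex.d k H j).hom _)
    rw [barComplex.d_single]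
    simp [Fin.comp_contractNth]
    exact (barComplex.d_single (k := k) j (s ∘ x)).trans rfl

lemma freeLift_aux {α : Type} (B : Rep.{0} k G) (f : α → B) (x : α) :
    (freeLift k G B f).hom (Finsupp.single x (.single 1 1)) = f x := by
  simp

lemma barMap_f_single (s : H →* G) (i : ℕ) (x : Fin i → H) :
    Hom.hom ((barMap (k := k) s).f i) (Finsupp.single x (.single 1 1)) =
      (Finsupp.single (s ∘ x) (.single 1 1)) :=
  freeLift_aux (res s (free k G (Fin i → G)))
    (fun x => Finsupp.single (s ∘ x) (.single 1 1)) x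

lemma barResolution_π_zero (x : Fin 0 → G) :
    ((barResolution k G).π.f 0).hom (Finsupp.single x (.single 1 1)) = (1 : k) := by
  have H : ∀ (m : ℕ) (f : Fin m → G) (g : G) (r : k), ∃ y : Fin (m + 1) → G,
        (diagonalSuccIsoFree k G m).inv.hom (Finsupp.single f (MonoidAlgebra.single g r)) =
          MonoidAlgebra.single y r := by
      intro m f g r
      refine ⟨(Action.diagonalSuccIsoTensorTrivial G m).inv.hom (g, f), ?_⟩
      simp only [diagonalSuccIsoFree, diagonalSuccIsoTensorTrivial, Iso.trans_inv, Rep.hom_comp,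
        Representation.IntertwiningMap.comp_apply]
      have step1 : (Hom.hom (leftRegularTensorTrivialIsoFree k G (Fin m → G)).inv)
          (Finsupp.single f (.single g r)) = .single g 1 ⊗ₜ[k] .single f r :=
        Representation.leftRegularTensorTrivialIsoFree_symm_apply_single_single f g r
      rw [step1]
      simp only [mkIso_inv, Representation.linearizeOfMulActionIso, Representation.Equiv.mk_symm,
        LinearEquiv.refl_symm, ConcreteCategory.hom_ofHom, Action.tensorObj_V, Action.trivial_V,
        Functor.mapIso_inv, tensor_V, tensor_ρ, Iso.symm_inv, Functor.Monoidal.μIso_hom, μ_hom,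
        MonoidalCategory.tensorIso_inv, Representation.linearizeTrivialIso, hom_tensorHom,
        Representation.IntertwiningMap.tensor_apply, Representation.Equiv.coe_toIntertwiningMap,
        Representation.Equiv.mk_apply, LinearEquiv.refl_apply]
      have key₁ := Representation.linearizeMap_single (k := k)
        (Action.diagonalSuccIsoTensorTrivial G m).inv (g, f) ((1 : k) * r)
      have key₂ := Representation.LinearizeMonoidal.μ_apply_single_single (k := k)
        (X := Action.leftRegular G) (Y := Action.trivial G (Fin m → G)) g f 1 r
      exact ((congrArg (fun z => (Representation.linearizeMap
        (Action.diagonalSuccIsoTensorTrivial G m).inv) z) key₂).trans key₁).trans (by simp)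
  obtain ⟨y, hy⟩ := H 0 x 1 1
  have this : (standardComplex.εToSingle₀ k G).f 0 = standardComplex.ε k G := by
    rw [standardComplex.εToSingle₀]
    exact ChainComplex.toSingle₀Equiv_symm_apply_f_zero (C := standardComplex k G)
      (X := Rep.trivial k G k) (standardComplex.ε k G) _
  have h3 : (standardComplex.ε k G).hom (MonoidAlgebra.single y 1) = (1 : k) := by
    simp only [standardComplex.ε]
    change (Finsupp.linearCombination _ fun _ ↦ (1 : k)) (MonoidAlgebra.coeffLinearEquiv k (MonoidAlgebra.single y (1 : k))) = _
    simp
  change Hom.hom ((standardComplex.εToSingle₀ k G).f 0) ((diagonalSuccIsoFree k G 0).inv.hom (Finsupp.single x (.single 1 1))) = (1 : k)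
  rw [hy, this]
  exact h3

lemma barMap_π :
    barMap (k := k) (MonoidHom.inl H G) ≫
      ((resFunctor (MonoidHom.inl H G)).mapProjectiveResolution (barResolution k (H × G))).π =
    (barResolution k H).π := by
  apply HomologicalComplex.to_single_hom_ext
  apply free_ext
  intro x
  refine Eq.trans ?_ (barResolution_π_zero (k := k) x).symm
  have e0 : (((resFunctor (MonoidHom.inl H G)).mapProjectiveResolution
      (barResolution k (H × G))).π).f 0 = (resFunctor (MonoidHom.inl H G)).map ((barResolution k (H × G)).π.f 0) := by
    simp [HomologicalComplex.singleMapHomologicalComplex]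
    exact Category.comp_id _
  have e2 : (Hom.hom ((barMap (k := k) (MonoidHom.inl H G)).f 0)) (Finsupp.single x (.single 1 1)) =
    Finsupp.single (MonoidHom.inl H G ∘ x) (.single 1 1) := barMap_f_single _ _ _
  have e3 := barResolution_π_zero (k := k) (MonoidHom.inl H G ∘ x)
  rw [← e2] at e3
  refine Eq.trans ?_ e3
  change Hom.hom ((((resFunctor (MonoidHom.inl H G)).mapProjectiveResolution
      (barResolution k (H × G))).π).f 0) ((Hom.hom ((barMap (k := k) (MonoidHom.inl H G)).f 0)) (Finsupp.single x (.single 1 1))) = _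
  rw [e0]
  rfl

def ev (s : H →* G) (A : Rep.{0} k H) : res s (coind s A) ⟶ A :=
  Rep.ofHom ⟨LinearMap.proj 1 ∘ₗ (A.ρ.coindV s).subtype, fun g => by
    ext x
    have := x.2 g 1
    rw [mul_one] at this
    change x.1 (1 * s g) = A.ρ g (x.1 1)
    rw [one_mul, this]⟩

/-- adj -/
def adjIso (s : H →* G) (X : ChainComplex (Rep.{0} k G) ℕ) (A : Rep.{0} k H) :
    X.linearYonedaObj k (coind s A) ≅
    ChainComplex.linearYonedaObj (((resFunctor s).mapHomologicalComplex _).obj X) k A :=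
  HomologicalComplex.Hom.isoOfComponents
    (fun _ ↦ (resCoindHomEquiv.{0} _ _ _).symm.toModuleIso) fun _ _ _ ↦ by
      rfl

lemma quasi (A : Rep.{0} k H) :
    QuasiIso (groupCohomology.cochainsMap (MonoidHom.inl H G) (ev (MonoidHom.inl H G) A)) := by
  have h := yonMap_quasiIso (heq (barResolution k H)
    ((resFunctor (MonoidHom.inl H G)).mapProjectiveResolution (barResolution k (H × G)))
    (barMap _) barMap_π) A
  have : groupCohomology.cochainsMap (MonoidHom.inl H G) (ev (MonoidHom.inl H G) A) =
    (groupCohomology.inhomogeneousCochainsIso _).hom ≫ (adjIso (MonoidHom.inl H G) (barComplex k (H × G)) A).hom ≫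
     yonMap (barMap (MonoidHom.inl H G)) A ≫ (groupCohomology.inhomogeneousCochainsIso A).inv := by
    ext i f x
    change (f (MonoidHom.inl H G ∘ x)).1 1 = ((Hom.hom (freeLift k (H × G) (coind (MonoidHom.inl H G) A) f)) (Hom.hom ((barMap (k := k) (MonoidHom.inl H G)).f i) (Finsupp.single x (.single 1 1)))).1 1
    have e2 : (Hom.hom ((barMap (k := k) (MonoidHom.inl H G)).f i)) (Finsupp.single x (.single 1 1)) =
      Finsupp.single (MonoidHom.inl H G ∘ x) (.single 1 1) := barMap_f_single _ _ _
    rw [e2]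
    refine congrArg (fun z => z.1 1) (freeLift_aux (coind (MonoidHom.inl H G) A) f _).symm
  rw [this]
  replace h : QuasiIso (yonMap (barMap (k := k) (MonoidHom.inl H G)) A) := h
  infer_instance

lemma antideriv {A : Type} [AddCommGroup A] (c : ℤ → A) : ∃ F : ℤ → A, ∀ n, F (n + 1) - F n = c n := by
  refine ⟨fun n => ∑ i ∈ Finset.range n.toNat, c i - ∑ i ∈ Finset.range (-n).toNat, c (-i - 1), ?_⟩
  intro n
  rcases n with n | n
  · have h1 : (Int.ofNat n + 1).toNat = n + 1 := by simp
    have h2 : (-(Int.ofNat n + 1)).toNat = 0 := by simp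
    have h3 : (Int.ofNat n).toNat = n := by simp
    have h4 : (-(Int.ofNat n)).toNat = 0 := by simp
    simp only [h1, h2, h3, h4, Finset.sum_range_succ]
    simp
  · have h1 : (Int.negSucc n + 1).toNat = 0 := by omega
    have h2 : (-(Int.negSucc n + 1)).toNat = n := by omega
    have h3 : (Int.negSucc n).toNat = 0 := by omega
    have h4 : (-(Int.negSucc n)).toNat = n + 1 := by omega
    have h5 : Int.negSucc n = -(n : ℤ) - 1 := by omega
    simp only [h1, h2, h3, h4, Finset.sum_range_succ]
    simp [h5]

variable (k H) (A : Type) [AddCommGroup A] [Module k A]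

/-- the coinduced module -/
abbrev MM : Rep.{0} k (H × Multiplicative ℤ) :=
  coind (MonoidHom.inl H (Multiplicative ℤ)) (Rep.trivial k H A)

/-- the constants -/
def iota : Rep.trivial k (H × Multiplicative ℤ) A ⟶ MM k H A :=
  Rep.ofHom ⟨LinearMap.codRestrict _ (LinearMap.pi fun _ => LinearMap.id) (fun a g h => rfl),
    fun g => rfl⟩

/-- the generator -/
abbrev tt : H × Multiplicative ℤ := (1, Multiplicative.ofAdd 1)

variable {H} in
lemma tt_comm (g : H × Multiplicative ℤ) : g * tt H = tt H * g := by
  ext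
  · simp
  · exact mul_comm g.2 _

/-- the difference -/
def diff : MM k H A ⟶ MM k H A :=
  Rep.ofHom ⟨(MM k H A).ρ (tt H) - LinearMap.id, fun g => by
    have : (MM k H A).ρ (tt H) ∘ₗ (MM k H A).ρ g = (MM k H A).ρ g ∘ₗ (MM k H A).ρ (tt H) := by
      change (MM k H A).ρ (tt H) * (MM k H A).ρ g = (MM k H A).ρ g * (MM k H A).ρ (tt H)
      rw [← map_mul, ← map_mul, tt_comm]
    rw [LinearMap.sub_comp, LinearMap.comp_sub, this]
    rfl⟩

lemma diff_apply (f : MM k H A) (x : H × Multiplicative ℤ) :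
    ((diff k H A).hom f).1 x = f.1 (x * tt H) - f.1 x := rfl

lemma iota_apply (a : A) (x : H × Multiplicative ℤ) :
    ((iota k H A).hom a).1 x = a := rfl

/-- the sequence -/
@[simps]
def SS : ShortComplex (Rep.{0} k (H × Multiplicative ℤ)) where
  X₁ := Rep.trivial k (H × Multiplicative ℤ) A
  X₂ := MM k H A
  X₃ := MM k H A
  f := iota k H A
  g := diff k H A
  zero := by
    ext a
    exact sub_self a

lemma SS_exact : (SS k H A).ShortExact where
  exact := by
    rw [← (SS k H A).exact_map_iff_of_faithful (forget₂ (Rep k (H × Multiplicative ℤ)) (ModuleCat k)),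
      ShortComplex.moduleCat_exact_iff]
    intro f hf
    change MM k H A at f
    change (diff k H A).hom f = 0 at hf
    refine ⟨(f.1 1 : A), ?_⟩
    change (iota k H A).hom (f.1 1) = f
    apply Subtype.ext
    funext x
    change f.1 1 = f.1 x
    have hH : ∀ (h : H) y, f.1 ((h, 1) * y) = f.1 y := fun h y => f.2 h y
    have ht : ∀ y, f.1 (y * tt H) = f.1 y := fun y => by
      have := congrFun (congrArg Subtype.val hf) y
      rw [diff_apply] at this
      exact sub_eq_zero.1 this
    have hz : ∀ n : ℤ, f.1 (1, Multiplicative.ofAdd n) = f.1 1 := by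
      intro n
      induction n with
      | zero => rfl
      | succ n ih => 
        rw [← ih, ← ht (1, Multiplicative.ofAdd (n : ℤ))]
        exact congrArg f.1 (Prod.ext (mul_one (1 : H)).symm rfl)
      | pred n ih =>
        rw [← ih, ← ht (1, Multiplicative.ofAdd (-(n : ℤ) - 1))]
        refine congrArg f.1 (Prod.ext ?_ ?_)
        · simp
        · change (-(n : ℤ) - 1) + 1 = -(n : ℤ)
          ring
    have := hH x.1 (1, x.2)
    rw [← hz x.2.toAdd]
    refine this.symm.trans ?_
    refine congrArg f.1 (Prod.ext ?_ ?_) <;> simp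
  mono_f := by
    rw [Rep.mono_iff_injective]
    intro a b hab
    exact congrFun (congrArg Subtype.val hab) 1
  epi_g := by
    rw [Rep.epi_iff_surjective]
    intro f
    change MM k H A at f
    obtain ⟨F, hF⟩ := antideriv (fun n => (f.1 (1, Multiplicative.ofAdd n) : A))
    refine ⟨⟨fun x => F x.2.toAdd, fun g x => by simp⟩, ?_⟩
    apply Subtype.ext
    funext x
    refine Eq.trans (hF x.2.toAdd) ?_
    refine (f.2 x.1 (1, x.2)).symm.trans ?_
    refine congrArg f.1 (Prod.ext ?_ ?_) <;> simp

/-- the Shapiro map -/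
abbrev psi (d : ℕ) : groupCohomology (MM k H A) d ⟶ groupCohomology (Rep.trivial k H A) d :=
  groupCohomology.map (MonoidHom.inl H (Multiplicative ℤ)) (ev _ (Rep.trivial k H A)) d

instance psi_iso (d : ℕ) : IsIso (psi k H A d) := by
  have := quasi (G := Multiplicative ℤ) (Rep.trivial k H A)
  exact inferInstanceAs (IsIso (HomologicalComplex.homologyMap _ d))

/-- inflation -/
def inflRep : res (MonoidHom.fst H (Multiplicative ℤ)) (Rep.trivial k H A) ⟶
    Rep.trivial k (H × Multiplicative ℤ) A :=
  Rep.ofHom ⟨LinearMap.id, fun _ => rfl⟩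

/-- inflation -/
abbrev infl (d : ℕ) : groupCohomology (Rep.trivial k H A) d ⟶
    groupCohomology (Rep.trivial k (H × Multiplicative ℤ) A) d :=
  groupCohomology.map (MonoidHom.fst H (Multiplicative ℤ))
    (inflRep k H A) d

/-- induced by the constants -/
abbrev iotaMap (d : ℕ) : groupCohomology (Rep.trivial k (H × Multiplicative ℤ) A) d ⟶
    groupCohomology (MM k H A) d :=
  groupCohomology.map (MonoidHom.id _) (iota k H A) d

lemma infl_comp (d : ℕ) : infl k H A d ≫ iotaMap k H A d ≫ psi k H A d = 𝟙 _ := by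
  rw [← groupCohomology.map_comp]
  refine (groupCohomology.map_comp (A := Rep.trivial k H A)
    (B := Rep.trivial k (H × Multiplicative ℤ) A) (C := Rep.trivial k H A)
    (MonoidHom.fst H (Multiplicative ℤ))
    ((MonoidHom.id (H × Multiplicative ℤ)).comp (MonoidHom.inl H (Multiplicative ℤ)))
    (inflRep k H A)
    ((resFunctor (MonoidHom.inl H (Multiplicative ℤ))).map (iota k H A) ≫
          ev (MonoidHom.inl H (Multiplicative ℤ)) (Rep.trivial k H A)) d).symm.trans ?_
  rw [← groupCohomology.map_id]
  exact groupCohomology.map_congr rfl rfl d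

lemma iotaMap_surj (d : ℕ) : Function.Surjective (iotaMap k H A d) := by
  intro y
  refine ⟨infl k H A d (psi k H A d y), ?_⟩
  have h : Function.Injective (psi k H A d) := by
    rw [← ModuleCat.mono_iff_injective]; infer_instance
  apply h
  exact congrArg (fun f => f.hom (psi k H A d y)) (infl_comp k H A d)

/-- connecting map -/
abbrev del (d : ℕ) : groupCohomology (MM k H A) d ⟶
    groupCohomology (Rep.trivial k (H × Multiplicative ℤ) A) (d + 1) :=
  groupCohomology.δ (SS_exact k H A) d (d + 1) rfl

lemma del_inj (d : ℕ) : Function.Injective (del k H A d) := by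
  have h3 := (ShortComplex.moduleCat_exact_iff _).1
    (groupCohomology.mapShortComplex₃_exact (SS_exact k H A) (i := d) rfl)
  have h2 := (groupCohomology.mapShortComplex₂ (SS k H A) d).zero
  refine (injective_iff_map_eq_zero (del k H A d).hom).2 fun x hx => ?_
  obtain ⟨y, rfl⟩ := h3 x hx
  obtain ⟨z, rfl⟩ := iotaMap_surj k H A d y
  exact congrArg (fun f => f.hom z) h2

lemma del_exact (d : ℕ) : Function.Exact (del k H A d).hom
    (iotaMap k H A (d + 1) ≫ psi k H A (d + 1)).hom := by
  have h1 := groupCohomology.mapShortComplex₁_exact (SS_exact k H A) (i := d) rfl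
  intro x
  constructor
  · intro hx
    refine (ShortComplex.moduleCat_exact_iff _).1 h1 x ?_
    have h : Function.Injective (psi k H A (d+1)) := by
      rw [← ModuleCat.mono_iff_injective]; infer_instance
    apply h
    refine Eq.trans hx (map_zero (psi k H A (d+1)).hom).symm
  · rintro ⟨y, rfl⟩
    have := congrArg (fun f => f.hom y) (groupCohomology.mapShortComplex₁ (SS_exact k H A) (i := d) rfl).zero
    refine Eq.trans (congrArg (psi k H A (d+1)).hom this) (map_zero _)

/-- the Kuenneth splitting -/
def split (d : ℕ) : groupCohomology (Rep.trivial k (H × Multiplicative ℤ) A) (d + 1) ≃+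
    groupCohomology (Rep.trivial k H A) d × groupCohomology (Rep.trivial k H A) (d + 1) :=
  (((del_exact k H A d).splitSurjectiveEquiv (del_inj k H A d))
    ⟨(infl k H A (d + 1)).hom, congrArg ModuleCat.Hom.hom (infl_comp k H A (d + 1))⟩).1.toAddEquiv.trans
    (AddEquiv.prodCongr (asIso (psi k H A d)).toLinearEquiv.toAddEquiv (AddEquiv.refl _))

end
end GCZn

theorem groupCohomology_zn (A : Type) [AddCommGroup A] (n d : ℕ) :
    Nonempty (groupCohomology (Rep.trivial ℤ (Multiplicative (Fin n → ℤ)) A) d ≃+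
      (Fin (n.choose d) → A)) ∧
    (n < d → ∀ x : groupCohomology (Rep.trivial ℤ (Multiplicative (Fin n → ℤ)) A) d,
      x = 0) := by
  have key : Nonempty (groupCohomology (Rep.trivial ℤ (Multiplicative (Fin n → ℤ)) A) d ≃+
      (Fin (n.choose d) → A)) := by
    induction n generalizing d with
    | zero =>
      cases d with
      | zero =>
        exact ⟨(groupCohomology.H0IsoOfIsTrivial
          (Rep.trivial ℤ (Multiplicative (Fin 0 → ℤ)) A)).toLinearEquiv.toAddEquiv.trans
          ((LinearEquiv.funUnique (Fin 1) ℤ A).symm.toAddEquiv)⟩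
      | succ d =>
        have : Subsingleton (groupCohomology (Rep.trivial ℤ (Multiplicative (Fin 0 → ℤ)) A) (d + 1)) :=
          ModuleCat.subsingleton_of_isZero
            (isZero_groupCohomology_succ_of_subsingleton _ d)
        have : IsEmpty (Fin (Nat.choose 0 (d + 1))) := by
          simp; infer_instance
        exact ⟨⟨⟨fun _ => 0, fun _ => 0, fun _ => Subsingleton.elim _ _, fun _ => Subsingleton.elim _ _⟩, fun _ _ => Subsingleton.elim _ _⟩⟩
    | succ n ih =>
      cases d with
      | zero =>
        exact ⟨(groupCohomology.H0IsoOfIsTrivial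
          (Rep.trivial ℤ (Multiplicative (Fin (n + 1) → ℤ)) A)).toLinearEquiv.toAddEquiv.trans
          ((LinearEquiv.funUnique (Fin 1) ℤ A).symm.toAddEquiv.trans
            (LinearEquiv.funCongrLeft ℤ A (finCongr (Nat.choose_zero_right (n + 1)))).toAddEquiv)⟩
      | succ d =>
        obtain ⟨e1⟩ := ih d
        obtain ⟨e2⟩ := ih (d + 1)
        let e : Multiplicative (Fin (n + 1) → ℤ) ≃*
            Multiplicative (Fin n → ℤ) × Multiplicative ℤ :=
          { toFun := fun x => (Multiplicative.ofAdd fun i => x.toAdd i.succ,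
              Multiplicative.ofAdd (x.toAdd 0))
            invFun := fun x => Multiplicative.ofAdd (Fin.cons x.2.toAdd x.1.toAdd)
            left_inv := fun x => by
              change Multiplicative.ofAdd (Fin.cons (x.toAdd 0) (Fin.tail x.toAdd)) = x
              rw [Fin.cons_self_tail]
              rfl
            right_inv := fun x => rfl
            map_mul' := fun x y => rfl }
        have i1 := (groupCohomology.mapIso (A := Rep.trivial ℤ (Multiplicative (Fin n → ℤ) × Multiplicative ℤ) A)
          (B := Rep.trivial ℤ (Multiplicative (Fin (n + 1) → ℤ)) A) e
          (LinearEquiv.refl ℤ A) (fun g => rfl) (d + 1)).toLinearEquiv.toAddEquiv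
        refine ⟨i1.trans ((GCZn.split ℤ _ A d).trans ((AddEquiv.prodCongr e1 e2).trans ?_))⟩
        exact ((LinearEquiv.sumArrowLequivProdArrow _ _ ℤ A).symm.trans
          (LinearEquiv.funCongrLeft ℤ A ((finCongr (Nat.choose_succ_succ n d)).trans
            finSumFinEquiv.symm))).toAddEquiv
  refine ⟨key, fun h x => ?_⟩
  obtain ⟨e⟩ := key
  have : IsEmpty (Fin (n.choose d)) := by
    rw [Nat.choose_eq_zero_of_lt h]; infer_instance
  exact e.injective (Subsingleton.elim _ _)
end
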